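/- Let U be a unital of order n ≥ 2 and let G_U be its incidence graph. Then i(G_U) ≥ 2(n³ + 1 − ⌊c(n)⌋) / (n²(n² + 1)). -/

import Mathlib

open Finset

/-- A 2-(v,k,λ) design with `b` blocks and `r` blocks through each point:
points form a finset `points` of size `v`, blocks a finset `blocks` of
`k`-element subsets of `points`, every pair of distinct points lying in
exactly `lam` blocks, where `v > k > lam ≥ 1`. -/
structure TwoDesign (α : Type*) [DecidableEq α] where
  v : ℕ
  b : ℕ
  r : ℕ
  k : ℕ
  lam : ℕ
  points : Finset α
  blocks : Finset (Finset α)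
  lam_pos : 0 < lam
  lam_lt_k : lam < k
  k_lt_v : k < v
  card_points : points.card = v
  card_blocks : blocks.card = b
  block_subset : ∀ B ∈ blocks, B ⊆ points
  card_block : ∀ B ∈ blocks, B.card = k
  pair_count : ∀ p ∈ points, ∀ q ∈ points, p ≠ q →
    (blocks.filter fun B => p ∈ B ∧ q ∈ B).card = lam
  point_count : ∀ p ∈ points, (blocks.filter fun B => p ∈ B).card = r

variable {α : Type*} [DecidableEq α]

/-- In the incidence graph, the neighbourhood of a set `X` of points:
the blocks containing at least one point of `X`. -/
def TwoDesign.blockNbhd (D : TwoDesign α) (X : Finset α) : Finset (Finset α) :=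
  D.blocks.filter fun B => ∃ p ∈ X, p ∈ B

/-- In the incidence graph, the neighbourhood of a set `Y` of blocks:
the points lying on at least one block of `Y`. -/
def TwoDesign.pointNbhd (D : TwoDesign α) (Y : Finset (Finset α)) : Finset α :=
  D.points.filter fun p => ∃ B ∈ Y, p ∈ B

/-- A unital of order `n`: a 2-(n³+1, n+1, 1) design; it has
`n⁴ - n³ + n²` blocks and `n²` blocks through each point. -/
def TwoDesign.IsUnital (D : TwoDesign α) (n : ℕ) : Prop :=
  D.v = n ^ 3 + 1 ∧ D.b = n ^ 4 - n ^ 3 + n ^ 2 ∧ D.r = n ^ 2 ∧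
    D.k = n + 1 ∧ D.lam = 1

/-- `c(n) = n² - (√(8n²+9) - 3)/2`. -/
noncomputable def cFun (n : ℕ) : ℝ :=
  (n : ℝ) ^ 2 - (Real.sqrt (8 * (n : ℝ) ^ 2 + 9) - 3) / 2

/-- The vertex-isoperimetric number of the incidence graph of `D`:
a subset `S` of the vertex set `P ∪ 𝓑` is encoded as the pair
`(X, Y) = (S ∩ P, S ∩ 𝓑)`; then `|S| = |X| + |Y|` and
`|N(S)| = |N(Y) \ X| + |N(X) \ Y|`. -/
noncomputable def isoInc (D : TwoDesign α) : ℝ :=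
  sInf { t : ℝ | ∃ X ⊆ D.points, ∃ Y ⊆ D.blocks,
    0 < X.card + Y.card ∧ 2 * (X.card + Y.card) ≤ D.v + D.b ∧
    t = (((D.pointNbhd Y \ X).card + (D.blockNbhd X \ Y).card : ℕ) : ℝ) /
        ((X.card + Y.card : ℕ) : ℝ) }

/-- In the non-incidence graph, the neighbourhood of a set `X` of points:
the blocks missing at least one point of `X`. -/
def TwoDesign.blockNbhdC (D : TwoDesign α) (X : Finset α) : Finset (Finset α) :=
  D.blocks.filter fun B => ∃ p ∈ X, p ∉ B

/-- In the non-incidence graph, the neighbourhood of a set `Y` of blocks: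
the points missed by at least one block of `Y`. -/
def TwoDesign.pointNbhdC (D : TwoDesign α) (Y : Finset (Finset α)) : Finset α :=
  D.points.filter fun p => ∃ B ∈ Y, p ∉ B

/-- The vertex-isoperimetric number of the non-incidence graph of `D`. -/
noncomputable def isoNonInc (D : TwoDesign α) : ℝ :=
  sInf { t : ℝ | ∃ X ⊆ D.points, ∃ Y ⊆ D.blocks,
    0 < X.card + Y.card ∧ 2 * (X.card + Y.card) ≤ D.v + D.b ∧
    t = (((D.pointNbhdC Y \ X).card + (D.blockNbhdC X \ Y).card : ℕ) : ℝ) /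
        ((X.card + Y.card : ℕ) : ℝ) }

/-- An arc of a design: a set of at least 3 points, no three collinear. -/
def TwoDesign.IsArc (D : TwoDesign α) (X : Finset α) : Prop :=
  X ⊆ D.points ∧ 3 ≤ X.card ∧ ∀ B ∈ D.blocks, (B ∩ X).card ≤ 2

/-- `m(U)`: the maximum size of an arc in the design. -/
noncomputable def maxArc (D : TwoDesign α) : ℕ :=
  sSup { k : ℕ | ∃ X : Finset α, D.IsArc X ∧ X.card = k }

namespace TwoDesign

/-- Double counting of triples `(B, p, q)` with `p ∈ B ∩ X` and `q ∈ B ∩ Z`. -/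
theorem sum_card_inter_mul_card_inter (D : TwoDesign α) (X Z : Finset α) :
    ∑ B ∈ D.blocks, (X ∩ B).card * (Z ∩ B).card =
      ∑ p ∈ X, ∑ q ∈ Z, (D.blocks.filter fun B => p ∈ B ∧ q ∈ B).card := by
  simp_rw [Finset.card_filter]
  have h : ∀ p ∈ X, ∑ q ∈ Z, ∑ B ∈ D.blocks, (if p ∈ B ∧ q ∈ B then 1 else 0) =
      ∑ B ∈ D.blocks, ∑ q ∈ Z, (if p ∈ B ∧ q ∈ B then 1 else 0) :=
    fun p _ => Finset.sum_comm
  rw [Finset.sum_congr rfl h, Finset.sum_comm]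
  refine Finset.sum_congr rfl fun B _ => ?_
  rw [← Finset.filter_mem_eq_inter, ← Finset.filter_mem_eq_inter, Finset.card_filter,
    Finset.card_filter, Finset.sum_mul_sum]
  refine Finset.sum_congr rfl fun p _ => Finset.sum_congr rfl fun q _ => ?_
  by_cases hp : p ∈ B <;> by_cases hq : q ∈ B <;> simp [hp, hq]

theorem sum_card_inter (D : TwoDesign α) {X : Finset α} (hX : X ⊆ D.points) :
    ∑ B ∈ D.blocks, (X ∩ B).card = D.r * X.card := by
  simp_rw [← Finset.filter_mem_eq_inter, Finset.card_filter]
  rw [Finset.sum_comm, Finset.sum_congr rfl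
    (fun p hp => (Finset.card_filter _ _).symm.trans (D.point_count p (hX hp)))]
  simp [mul_comm]

theorem sum_card_inter_mul_of_disjoint (D : TwoDesign α) {X Z : Finset α}
    (hX : X ⊆ D.points) (hZ : Z ⊆ D.points) (h : Disjoint X Z) :
    ∑ B ∈ D.blocks, (X ∩ B).card * (Z ∩ B).card = X.card * Z.card * D.lam := by
  rw [D.sum_card_inter_mul_card_inter, Finset.sum_congr rfl fun p hp =>
    Finset.sum_congr rfl fun q hq => D.pair_count p (hX hp) q (hZ hq)
      (Finset.disjoint_left.1 h hp <| · ▸ hq)]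
  simp [mul_assoc]

theorem sum_card_inter_sq (D : TwoDesign α) {X : Finset α} (hX : X ⊆ D.points) :
    ∑ B ∈ D.blocks, (X ∩ B).card ^ 2 + X.card * D.lam =
      X.card * D.r + X.card ^ 2 * D.lam := by
  have key : ∀ p ∈ X, ∑ q ∈ X, (D.blocks.filter fun B => p ∈ B ∧ q ∈ B).card + D.lam =
      D.r + X.card * D.lam := by
    intro p hp
    rw [← Finset.add_sum_erase X _ hp, Finset.sum_congr rfl fun q hq =>
      D.pair_count p (hX hp) q (hX (Finset.mem_of_mem_erase hq)) (Finset.ne_of_mem_erase hq).symm]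
    have := D.point_count p (hX hp)
    simp only [and_self, this, Finset.sum_const, smul_eq_mul]
    rw [← Finset.card_erase_add_one hp]
    ring
  have := Finset.sum_congr rfl key
  rw [Finset.sum_add_distrib] at this
  simp only [Finset.sum_const, smul_eq_mul] at this
  simp_rw [sq (Finset.card (_ ∩ _))]
  rw [D.sum_card_inter_mul_card_inter, this]
  ring

theorem mem_blockNbhd (D : TwoDesign α) {X B : Finset α} :
    B ∈ D.blockNbhd X ↔ B ∈ D.blocks ∧ (X ∩ B).card ≠ 0 := by
  simp only [blockNbhd, Finset.mem_filter, ne_eq, Finset.card_eq_zero,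
    ← Finset.nonempty_iff_ne_empty, Finset.Nonempty, Finset.mem_inter]

theorem sum_blockNbhd (D : TwoDesign α) (X : Finset α) (g : ℕ → ℕ) (hg : g 0 = 0) :
    ∑ B ∈ D.blockNbhd X, g (X ∩ B).card = ∑ B ∈ D.blocks, g (X ∩ B).card := by
  refine Finset.sum_subset (Finset.filter_subset _ _) fun B hB hB' => ?_
  rw [D.mem_blockNbhd] at hB'
  have : (X ∩ B).card = 0 := by tauto
  rw [this, hg]

/-- The bound on the number of blocks meeting `X` which is sharp for arcs. -/
theorem card_blockNbhd_arc_bound (D : TwoDesign α) (hl : D.lam = 1) {X : Finset α}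
    (hX : X ⊆ D.points) :
    2 * D.r * X.card + X.card ≤ 2 * (D.blockNbhd X).card + X.card ^ 2 := by
  have h1 := D.sum_card_inter hX
  have h2 := D.sum_card_inter_sq hX
  rw [← D.sum_blockNbhd X (fun a => a) rfl] at h1
  rw [← D.sum_blockNbhd X (fun a => a ^ 2) rfl, hl] at h2
  have h3 : ∑ B ∈ D.blockNbhd X, 3 * (X ∩ B).card ≤
      ∑ B ∈ D.blockNbhd X, ((X ∩ B).card ^ 2 + 2) := by
    refine Finset.sum_le_sum fun B hB => ?_
    have h0 := (D.mem_blockNbhd.1 hB).2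
    generalize (X ∩ B).card = a at h0
    obtain _ | _ | a := a
    · contradiction
    · norm_num
    · nlinarith
  rw [← Finset.mul_sum, Finset.sum_add_distrib] at h3
  simp only [Finset.sum_const, smul_eq_mul] at h3
  nlinarith

/-- The Cauchy–Schwarz bound on the number of blocks meeting `X`. -/
theorem card_blockNbhd_sq_bound (D : TwoDesign α) (hl : D.lam = 1) {X : Finset α}
    (hX : X ⊆ D.points) :
    D.r ^ 2 * X.card + (D.blockNbhd X).card ≤ (D.blockNbhd X).card * (D.r + X.card) := by
  rcases X.eq_empty_or_nonempty with rfl | hne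
  · simp [blockNbhd]
  have h1 := D.sum_card_inter hX
  have h2 := D.sum_card_inter_sq hX
  rw [← D.sum_blockNbhd X (fun a => a) rfl] at h1
  rw [← D.sum_blockNbhd X (fun a => a ^ 2) rfl, hl] at h2
  have h3 := sq_sum_le_card_mul_sum_sq (s := D.blockNbhd X) (f := fun B => (X ∩ B).card)
  rw [h1] at h3
  have hx : 0 < X.card := hne.card_pos
  refine Nat.le_of_mul_le_mul_left ?_ hx
  generalize (∑ B ∈ D.blockNbhd X, (X ∩ B).card ^ 2) = Q at *
  have := congrArg (fun t => (D.blockNbhd X).card * t) h2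
  nlinarith

/-- Each block contains few pairs from `X × Z`, so many blocks meet both sets. -/
theorem card_mul_card_le_of_disjoint (D : TwoDesign α) (hl : D.lam = 1) {X Z : Finset α}
    (hX : X ⊆ D.points) (hZ : Z ⊆ D.points) (h : Disjoint X Z) :
    4 * (X.card * Z.card) ≤ D.k ^ 2 * (D.blockNbhd X ∩ D.blockNbhd Z).card := by
  have h1 := D.sum_card_inter_mul_of_disjoint hX hZ h
  rw [hl, mul_one] at h1
  rw [← h1, ← Finset.sum_subset (s₁ := D.blockNbhd X ∩ D.blockNbhd Z), Finset.mul_sum, mul_comm,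
    ← smul_eq_mul (a := Finset.card _)]
  · refine Finset.sum_le_card_nsmul _ _ _ fun B hB => ?_
    have hB' := (D.mem_blockNbhd.1 (Finset.mem_inter.1 hB).1).1
    have h2 : (X ∩ B).card + (Z ∩ B).card ≤ D.k := by
      rw [← D.card_block B hB', ← Finset.card_union_of_disjoint
        (h.mono Finset.inter_subset_left Finset.inter_subset_left)]
      exact Finset.card_le_card
        (Finset.union_subset Finset.inter_subset_right Finset.inter_subset_right)
    zify at h2 ⊢
    nlinarith [sq_nonneg (((X ∩ B).card : ℤ) - (Z ∩ B).card)]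
  · exact Finset.inter_subset_left.trans (Finset.filter_subset _ _)
  · intro B hB hB'
    rw [Finset.mem_inter, D.mem_blockNbhd, D.mem_blockNbhd] at hB'
    rw [mul_eq_zero]
    tauto

theorem blockNbhd_mono (D : TwoDesign α) {X Z : Finset α} (h : X ⊆ Z) :
    D.blockNbhd X ⊆ D.blockNbhd Z := by
  intro B hB
  simp only [blockNbhd, Finset.mem_filter] at hB ⊢
  obtain ⟨hB, p, hp, hpB⟩ := hB
  exact ⟨hB, p, h hp, hpB⟩

theorem le_card_blockNbhd_of_r_le (D : TwoDesign α) (hl : D.lam = 1) {X : Finset α}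
    (hX : X ⊆ D.points) (hr : D.r ≤ X.card) :
    D.r ^ 2 + D.r ≤ 2 * (D.blockNbhd X).card := by
  obtain ⟨Z, hZX, hZ⟩ := Finset.exists_subset_card_eq hr
  have h1 := D.card_blockNbhd_arc_bound hl (hZX.trans hX)
  have h2 := Finset.card_le_card (D.blockNbhd_mono hZX)
  rw [hZ] at h1
  nlinarith

end TwoDesign

/-- `T = n² - ⌊c(n)⌋` is the least natural number with `T (T + 3) ≥ 2 n²`. -/
theorem sq_sub_floor_cFun_bounds (n : ℕ) :
    ∃ T : ℤ, ⌊cFun n⌋ = (n : ℤ) ^ 2 - T ∧ 0 ≤ T ∧ 2 * (n : ℤ) ^ 2 ≤ T * (T + 3) ∧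
      T * (T + 1) ≤ 2 * (n : ℤ) ^ 2 := by
  refine ⟨(n : ℤ) ^ 2 - ⌊cFun n⌋, by ring, ?_⟩
  have h1 := Int.floor_le (cFun n)
  have h2 := Int.lt_floor_add_one (cFun n)
  obtain ⟨T, hT⟩ : ∃ T : ℤ, T = (n : ℤ) ^ 2 - ⌊cFun n⌋ := ⟨_, rfl⟩
  have hf : ⌊cFun n⌋ = (n : ℤ) ^ 2 - T := by omega
  rw [hf] at h1 h2 ⊢
  rw [sub_sub_cancel]
  unfold cFun at h1 h2
  push_cast at h1 h2
  have hs0 : (3 : ℝ) ≤ √(8 * (n : ℝ) ^ 2 + 9) := Real.le_sqrt_of_sq_le (by nlinarith)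
  have hs := Real.sq_sqrt (show (0 : ℝ) ≤ 8 * (n : ℝ) ^ 2 + 9 by positivity)
  generalize √(8 * (n : ℝ) ^ 2 + 9) = s at *
  have a1 : s ≤ 2 * T + 3 := by linarith
  have a2 : (2 * T + 1 : ℝ) < s := by linarith
  have hT0 : 0 ≤ T := by
    have : (0 : ℝ) ≤ T := by linarith
    exact_mod_cast this
  have hTr : (0 : ℝ) ≤ T := by exact_mod_cast hT0
  refine ⟨hT0, ?_, ?_⟩
  · have : (2 * (n : ℝ) ^ 2) ≤ T * (T + 3) := by nlinarith
    exact_mod_cast this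
  · have h3 : (T * (T + 1) : ℝ) < 2 * (n : ℝ) ^ 2 + 2 := by nlinarith
    have h4 : T * (T + 1) < 2 * (n : ℤ) ^ 2 + 2 := by exact_mod_cast h3
    obtain ⟨j, hj⟩ := Int.even_mul_succ_self T
    omega

section Numerics

variable {n T x x' m : ℤ}

theorem two_mul_lt_three_mul (hn : 2 ≤ n) (h2 : T * (T + 1) ≤ 2 * n ^ 2) (hT : 0 ≤ T) :
    2 * T < 3 * n := by
  by_contra! h
  nlinarith

theorem small_order_cases (hn : 2 ≤ n) (hT : 0 ≤ T) (h1 : 2 * n ^ 2 ≤ T * (T + 3))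
    (h2 : T * (T + 1) ≤ 2 * n ^ 2) :
    (n = 2 ∧ T = 2) ∨ (n = 3 ∧ T = 3) ∨ (n = 4 ∧ T = 5) ∨ 5 ≤ n := by
  rcases lt_or_ge n 5 with h | h
  · have := two_mul_lt_three_mul hn h2 hT
    have hT6 : T < 6 := by linarith
    interval_cases n <;> interval_cases T <;> simp_all
  · tauto

theorem add_sub_le_of_both_small (hn : 2 ≤ n) (hT : 0 ≤ T) (h1 : 2 * n ^ 2 ≤ T * (T + 3))
    (h2 : T * (T + 1) ≤ 2 * n ^ 2) (hx : 0 ≤ x) (hx' : 0 ≤ x')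
    (hxC : x ≤ n ^ 2 - T) (hxC' : x' ≤ n ^ 2 - T) (hm : 4 * (x * x') ≤ (n + 1) ^ 2 * m) :
    x + x' - (n ^ 2 - T) ≤ m := by
  have hTn := two_mul_lt_three_mul hn h2 hT
  rcases eq_or_lt_of_le hn with rfl | hn3
  · obtain rfl : T = 2 := by
      rcases small_order_cases le_rfl hT h1 h2 with h | h | h | h <;> omega
    norm_num at hxC hxC' hm ⊢
    interval_cases x <;> interval_cases x' <;> omega
  · have hC : (n + 1) ^ 2 ≤ 4 * (n ^ 2 - T) := by nlinarith
    generalize n ^ 2 - T = C at hxC hxC' hC ⊢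
    have hk : 0 < (n + 1) ^ 2 := by positivity
    by_contra! hlt
    have e1 : (n + 1) ^ 2 * m < (n + 1) ^ 2 * (x + x' - C) := by gcongr
    have e2 : (n + 1) ^ 2 * (x + x' - C) ≤ 4 * C * (x + x' - C) ∨ x + x' - C < 0 := by
      rcases lt_or_ge (x + x' - C) 0 with h | h
      · exact Or.inr h
      · exact Or.inl (by gcongr)
    rcases e2 with e2 | e2
    · nlinarith [mul_nonneg (sub_nonneg.2 hxC) (sub_nonneg.2 hxC')]
    · nlinarith [mul_nonneg hx hx']

theorem add_sub_le_or_of_mid (hn : 2 ≤ n) (hT : 0 ≤ T) (h1 : 2 * n ^ 2 ≤ T * (T + 3))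
    (h2 : T * (T + 1) ≤ 2 * n ^ 2) (hx' : 0 ≤ x')
    (hxC : n ^ 2 - T < x) (hxn : x < n ^ 2) (hxC' : x' ≤ n ^ 2 - T)
    (hm : 4 * (x * x') ≤ (n + 1) ^ 2 * m) :
    x + x' - (n ^ 2 - T) ≤ m ∨
      (n ^ 2 - x) * (n ^ 2 - x + 1) ≤ 2 * (n ^ 2 - T - x') := by
  have hTn := two_mul_lt_three_mul hn h2 hT
  rcases small_order_cases hn hT h1 h2 with ⟨rfl, rfl⟩ | ⟨rfl, rfl⟩ | ⟨rfl, rfl⟩ | h5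
  · norm_num at *
    interval_cases x <;> interval_cases x' <;> omega
  · norm_num at *
    interval_cases x <;> interval_cases x' <;> omega
  · norm_num at *
    interval_cases x <;> interval_cases x' <;> omega
  · have hx2 : (n + 1) ^ 2 ≤ 2 * x := by nlinarith
    have hk : 0 < (n + 1) ^ 2 := by positivity
    have hm2 : 2 * x' ≤ m := by
      refine le_of_mul_le_mul_left ?_ hk
      nlinarith
    by_cases hc : x - (n ^ 2 - T) ≤ x'
    · left; linarith
    · right
      obtain ⟨u, hu⟩ : ∃ u, u = n ^ 2 - x := ⟨_, rfl⟩
      rw [← hu]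
      have hu1 : 1 ≤ u := by omega
      have huT : u + 1 ≤ T := by omega
      have : x' ≤ T - u - 1 := by omega
      nlinarith

theorem iso_bound_of_large_complement {y z : ℤ} (hn : 2 ≤ n) (hT : 0 ≤ T)
    (h1 : 2 * n ^ 2 ≤ T * (T + 3)) (h2 : T * (T + 1) ≤ 2 * n ^ 2) (hx : 0 ≤ x)
    (hxz : x ≤ z) (hzC : z ≤ n ^ 3 - (n ^ 2 - T)) (hy : 0 ≤ y)
    (hyz : y * (n ^ 3 + n ^ 2 - z) ≤ n ^ 2 * (n - 1) * z)
    (hm : 4 * (x * (n ^ 3 + 1 - z)) ≤ (n + 1) ^ 2 * m) :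
    2 * (n ^ 3 + 1 - (n ^ 2 - T)) * (x + y) ≤ n ^ 2 * (n ^ 2 + 1) * (z - x + m) := by
  have hTn := two_mul_lt_three_mul hn h2 hT
  have hkey : 2 * (n ^ 3 + 1 - (n ^ 2 - T)) * (n - 1) ≤ (n ^ 2 + 1) * (2 * n ^ 2 - T) := by
    obtain ⟨a, rfl⟩ : ∃ a, n = a + 2 := ⟨n - 2, by ring⟩
    have ha : 0 ≤ a := by linarith
    have hcoef : 0 ≤ (a + 2) ^ 2 + 1 + 2 * (a + 1) := by positivity
    have := mul_le_mul_of_nonneg_left hTn.le hcoef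
    nlinarith [pow_nonneg ha 2, pow_nonneg ha 3, pow_nonneg ha 4]
  have hz : 0 ≤ z := hx.trans hxz
  have hK : 0 ≤ n ^ 3 + 1 - (n ^ 2 - T) := by linarith
  have hpos : 0 < n ^ 3 + n ^ 2 - z := by nlinarith
  have hyN : 2 * (n ^ 3 + 1 - (n ^ 2 - T)) * y ≤ n ^ 2 * (n ^ 2 + 1) * z := by
    refine le_of_mul_le_mul_right ?_ hpos
    calc 2 * (n ^ 3 + 1 - (n ^ 2 - T)) * y * (n ^ 3 + n ^ 2 - z)
        = 2 * (n ^ 3 + 1 - (n ^ 2 - T)) * (y * (n ^ 3 + n ^ 2 - z)) := by ring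
      _ ≤ 2 * (n ^ 3 + 1 - (n ^ 2 - T)) * (n ^ 2 * (n - 1) * z) := by gcongr
      _ = n ^ 2 * z * (2 * (n ^ 3 + 1 - (n ^ 2 - T)) * (n - 1)) := by ring
      _ ≤ n ^ 2 * z * ((n ^ 2 + 1) * (2 * n ^ 2 - T)) := by gcongr
      _ ≤ n ^ 2 * z * ((n ^ 2 + 1) * (n ^ 3 + n ^ 2 - z)) :=
          mul_le_mul_of_nonneg_left
            (mul_le_mul_of_nonneg_left (by linarith) (by positivity)) (by positivity)
      _ = _ := by ring
  have hm' : 4 * (n ^ 2 - T + 1) * x ≤ (n + 1) ^ 2 * m := by nlinarith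
  rcases small_order_cases hn hT h1 h2 with ⟨rfl, rfl⟩ | ⟨rfl, rfl⟩ | ⟨rfl, rfl⟩ | h5
  · norm_num at *
    nlinarith
  · norm_num at *
    linarith
  · norm_num at *
    linarith
  · have hC2 : (n + 1) ^ 2 ≤ 2 * (n ^ 2 - T + 1) := by nlinarith
    have hk : 0 < (n + 1) ^ 2 := by positivity
    have hm2 : 2 * x ≤ m := by
      refine le_of_mul_le_mul_left ?_ hk
      nlinarith
    have hNK : 2 * (n ^ 3 + 1 - (n ^ 2 - T)) ≤ n ^ 2 * (n ^ 2 + 1) := by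
      nlinarith [mul_nonneg (sub_nonneg.2 h5) (pow_nonneg (by linarith : 0 ≤ n) 3)]
    have hN : 0 ≤ n ^ 2 * (n ^ 2 + 1) := by positivity
    nlinarith [mul_le_mul_of_nonneg_right hNK hx, mul_le_mul_of_nonneg_left hm2 hN]

end Numerics

theorem TwoDesign.IsUnital.iso_bound {n : ℕ} (hn : 2 ≤ n) {D : TwoDesign α} (hU : D.IsUnital n)
    {X : Finset α} (hX : X ⊆ D.points) {Y : Finset (Finset α)} (hY : Y ⊆ D.blocks)
    (hS : 2 * (X.card + Y.card) ≤ D.v + D.b) :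
    2 * ((n : ℤ) ^ 3 + 1 - ⌊cFun n⌋) * (X.card + Y.card) ≤
      (n : ℤ) ^ 2 * ((n : ℤ) ^ 2 + 1) *
        ((D.pointNbhd Y \ X).card + (D.blockNbhd X \ Y).card) := by
  obtain ⟨hv, hb, hr, hk, hl⟩ := hU
  obtain ⟨T, hfl, hT, h1, h2⟩ := sq_sub_floor_cFun_bounds n
  have hnZ : (2 : ℤ) ≤ n := by exact_mod_cast hn
  have hTn := two_mul_lt_three_mul hnZ h2 hT
  -- the points outside `X` and its neighbourhood
  obtain ⟨Z, hZ⟩ : ∃ Z, Z = (D.points \ X) \ D.pointNbhd Y := ⟨_, rfl⟩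
  have hZP : Z ⊆ D.points := hZ ▸ Finset.sdiff_subset.trans Finset.sdiff_subset
  have hXZ : Disjoint X Z := by
    rw [hZ, Finset.disjoint_left]; intro p hp; simp [hp]
  have hYZ : Disjoint Y (D.blockNbhd Z) := by
    rw [Finset.disjoint_left]
    intro B hB hB'
    obtain ⟨_, p, hp, hpB⟩ := Finset.mem_filter.1 hB'
    rw [hZ, Finset.mem_sdiff] at hp
    exact hp.2 (Finset.mem_filter.2 ⟨(Finset.mem_sdiff.1 hp.1).1, B, hB, hpB⟩)
  have cP : (D.pointNbhd Y \ X).card + X.card + Z.card = n ^ 3 + 1 := by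
    have e : (D.points \ X) ∩ D.pointNbhd Y = D.pointNbhd Y \ X := by
      ext p
      simp only [Finset.mem_inter, Finset.mem_sdiff, TwoDesign.pointNbhd, Finset.mem_filter]
      tauto
    have e1 := Finset.card_inter_add_card_sdiff (D.points \ X) (D.pointNbhd Y)
    have e2 := Finset.card_sdiff_add_card_eq_card hX
    rw [e, ← hZ] at e1
    have := D.card_points
    omega
  have cB : (D.blockNbhd X).card ≤ (D.blockNbhd X \ Y).card + Y.card := by
    have := Finset.le_card_sdiff Y (D.blockNbhd X)
    omega
  have cM : (D.blockNbhd X ∩ D.blockNbhd Z).card ≤ (D.blockNbhd X \ Y).card := by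
    refine Finset.card_le_card fun B hB => ?_
    rw [Finset.mem_inter] at hB
    exact Finset.mem_sdiff.2 ⟨hB.1, fun h => Finset.disjoint_left.1 hYZ h hB.2⟩
  have cY : Y.card + (D.blockNbhd Z).card ≤ n ^ 4 - n ^ 3 + n ^ 2 := by
    rw [← Finset.card_union_of_disjoint hYZ, ← hb, ← D.card_blocks]
    exact Finset.card_le_card (Finset.union_subset hY (Finset.filter_subset _ _))
  have bM := D.card_mul_card_le_of_disjoint hl hX hZP hXZ
  have bA := D.card_blockNbhd_arc_bound hl hX
  have bS := D.card_blockNbhd_sq_bound hl hZP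
  have bL := D.le_card_blockNbhd_of_r_le hl hX
  rw [hv, hb] at hS
  rw [hk] at bM
  rw [hr] at bA bS bL
  have h34 : n ^ 3 ≤ n ^ 4 := Nat.pow_le_pow_right (by omega) (by norm_num)
  zify [h34] at hS cP cB cM cY bM bA bS bL
  rw [hfl]
  have ha0 : (0 : ℤ) ≤ (D.pointNbhd Y \ X).card := by positivity
  generalize ((D.pointNbhd Y \ X).card : ℤ) = a at *
  have hx0 : (0 : ℤ) ≤ X.card := by positivity
  have hz0 : (0 : ℤ) ≤ Z.card := by positivity
  have hy0 : (0 : ℤ) ≤ Y.card := by positivity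
  generalize (X.card : ℤ) = x at *
  generalize (Y.card : ℤ) = y at *
  generalize (Z.card : ℤ) = x' at *
  generalize ((D.blockNbhd X).card : ℤ) = f at *
  generalize ((D.blockNbhd Z).card : ℤ) = f' at *
  generalize ((D.blockNbhd X \ Y).card : ℤ) = e at *
  generalize ((D.blockNbhd X ∩ D.blockNbhd Z).card : ℤ) = m at *
  generalize (n : ℤ) = n at *
  have hm : 4 * (x * x') ≤ (n + 1) ^ 2 * e :=
    bM.trans (mul_le_mul_of_nonneg_left cM (by positivity))
  have hN : 0 ≤ n ^ 2 * (n ^ 2 + 1) := by positivity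
  have hs : 2 * (x + y) ≤ n ^ 2 * (n ^ 2 + 1) := by
    obtain ⟨j, hj⟩ := Int.even_mul_succ_self (n ^ 2)
    have : n ^ 4 + n ^ 2 = n ^ 2 * (n ^ 2 + 1) := by ring
    omega
  have hK : 0 ≤ n ^ 3 + 1 - (n ^ 2 - T) := by nlinarith [pow_nonneg (by linarith : 0 ≤ n) 2]
  have finish : n ^ 3 + 1 - (n ^ 2 - T) ≤ a + e →
      2 * (n ^ 3 + 1 - (n ^ 2 - T)) * (x + y) ≤ n ^ 2 * (n ^ 2 + 1) * (a + e) := by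
    intro h
    calc 2 * (n ^ 3 + 1 - (n ^ 2 - T)) * (x + y)
        = (n ^ 3 + 1 - (n ^ 2 - T)) * (2 * (x + y)) := by ring
      _ ≤ (a + e) * (n ^ 2 * (n ^ 2 + 1)) := mul_le_mul h hs (by linarith) (hK.trans h)
      _ = _ := by ring
  rcases lt_or_ge (n ^ 2 - T) x' with hx'C | hx'C
  · have hy : y * (n ^ 3 + n ^ 2 - (n ^ 3 + 1 - x')) ≤ n ^ 2 * (n - 1) * (n ^ 3 + 1 - x') := by
      have hc : 0 ≤ n ^ 2 + x' - 1 := by nlinarith only [hnZ, hz0]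
      linarith only [mul_le_mul_of_nonneg_right cY hc, bS]
    have := iso_bound_of_large_complement (x := x) (y := y) (z := n ^ 3 + 1 - x') (m := e)
      hnZ hT h1 h2 hx0 (by linarith only [cP, ha0]) (by linarith only [hx'C]) hy0 hy
      (by rwa [sub_sub_cancel])
    rwa [show n ^ 3 + 1 - x' - x + e = a + e by linarith only [cP]] at this
  apply finish
  rcases le_or_gt x (n ^ 2 - T) with hxC | hxC
  · have := add_sub_le_of_both_small hnZ hT h1 h2 hx0 hz0 hxC hx'C hm
    linarith
  · rcases le_or_gt (n ^ 2) x with hxn | hxn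
    · have := bL hxn
      nlinarith
    · rcases add_sub_le_or_of_mid hnZ hT h1 h2 hz0 hxC hxn hx'C hm with h | h
      · linarith only [h, cP]
      · linarith only [h, bA, cB, cP, hs]

theorem iso_inc_lower_bound (n : ℕ) (hn : 2 ≤ n) (D : TwoDesign α) (hU : D.IsUnital n) :
    isoInc D ≥ 2 * ((n : ℝ) ^ 3 + 1 - (⌊cFun n⌋ : ℝ)) /
      ((n : ℝ) ^ 2 * ((n : ℝ) ^ 2 + 1)) := by
  refine le_csInf ?_ ?_
  · obtain ⟨p, hp⟩ : D.points.Nonempty := by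
      rw [← Finset.card_pos, D.card_points, hU.1]
      positivity
    have : 2 ≤ D.v := by
      rw [hU.1]
      have := Nat.pow_le_pow_left hn 3
      omega
    exact ⟨_, {p}, by simpa using hp, ∅, by simp, by simp, by simp; omega, rfl⟩
  · rintro t ⟨X, hX, Y, hY, hpos, hS, rfl⟩
    have hn0 : (0 : ℝ) < n := by positivity
    rw [div_le_div_iff₀ (by positivity) (by exact_mod_cast hpos)]
    have := hU.iso_bound hn hX hY hS
    have h : (2 * ((n : ℝ) ^ 3 + 1 - ⌊cFun n⌋) * (X.card + Y.card) ≤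
      (n : ℝ) ^ 2 * ((n : ℝ) ^ 2 + 1) *
        ((D.pointNbhd Y \ X).card + (D.blockNbhd X \ Y).card)) := by exact_mod_cast this
    push_cast
    linarith
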